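/- Let κ be a regular cardinal and let 𝓡 ⊆ [κ]^κ be an unreaped (𝔯_κ) family. Then the collection 𝓗 = {p_y : y ∈ 𝓡}, where p_y(α) = min(y ∩ [α, κ)) for α < κ, is a big family of functions in κ^κ. -/

import Mathlib

open Cardinal

/-- A set of ordinals, viewed as a subset of the cardinal `κ`, has cardinality `κ`. -/
def HasCardOf (s : Set Ordinal.{0}) (κ : Cardinal.{0}) : Prop :=
  #↥s = Cardinal.lift.{1} κ

/-- `S ∈ [κ]^κ` splits `B ∈ [κ]^κ` iff `|S ∩ B| = |(κ ∖ S) ∩ B| = κ`. -/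
def Splits (κ : Cardinal.{0}) (S B : Set Ordinal) : Prop :=
  HasCardOf (S ∩ B) κ ∧ HasCardOf ((Set.Iio κ.ord \ S) ∩ B) κ

/-- A family `A ⊆ [κ]^κ` is unreaped (an `𝔯_κ` family) iff no single `S ∈ [κ]^κ`
splits every element of `A`. -/
def Unreaped (κ : Cardinal.{0}) (A : Set (Set Ordinal)) : Prop :=
  ¬ ∃ S : Set Ordinal, S ⊆ Set.Iio κ.ord ∧ HasCardOf S κ ∧ ∀ y ∈ A, Splits κ S y

/-- A family `H ⊆ κ^κ` is big iff for every `F ⊆ [κ]^κ` and every `g : κ → κ` such that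
`{β < κ : f(β) ≤ g(β)} ∈ F` for every `f ∈ H`, there is an increasing `<κ`-to-one
function `h : κ → κ` for which `{h''(y ∩ z) : y, z ∈ F}` is an unreaped family. -/
def BigFamily (κ : Cardinal.{0}) (H : Set (Ordinal.{0} → Ordinal.{0})) : Prop :=
  ∀ (F : Set (Set Ordinal)) (g : Ordinal.{0} → Ordinal.{0}),
    (∀ y ∈ F, y ⊆ Set.Iio κ.ord ∧ HasCardOf y κ) →
    (∀ β < κ.ord, g β < κ.ord) →
    (∀ f ∈ H, {β : Ordinal | β < κ.ord ∧ f β ≤ g β} ∈ F) →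
    ∃ h : Ordinal.{0} → Ordinal.{0},
      MonotoneOn h (Set.Iio κ.ord) ∧
      (∀ β < κ.ord, h β < κ.ord) ∧
      (∀ ξ : Ordinal, #↥(Set.Iio κ.ord ∩ h ⁻¹' {ξ}) < Cardinal.lift.{1} κ) ∧
      Unreaped κ {w : Set Ordinal | ∃ y ∈ F, ∃ z ∈ F, w = h '' (y ∩ z)}

/-- For `y ∈ [κ]^κ`, the projection `p_y : κ → κ`, `p_y(α) = min (y ∩ [α, κ))`. -/
noncomputable def proj (y : Set Ordinal.{0}) (α : Ordinal.{0}) : Ordinal.{0} :=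
  sInf (y ∩ Set.Ici α)

theorem aux_bdd {κ : Cardinal.{0}} (hreg : κ.IsRegular) {s : Set Ordinal.{0}}
    (hs : s ⊆ Set.Iio κ.ord) (hc : #↥s < Cardinal.lift.{1} κ) :
    ∃ γ < κ.ord, ∀ x ∈ s, x < γ := by
  refine ⟨sSup ((· + 1) '' s), ?_, ?_⟩
  · apply Ordinal.sSup_add_one_lt_of_lt_cof _ hs
    rw [← Ordinal.lift_cof, hreg.cof_ord]
    exact hc
  · intro x hx
    have hb : BddAbove ((· + 1) '' s) := by
      refine ⟨κ.ord, ?_⟩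
      rintro _ ⟨a, ha, rfl⟩
      exact Order.add_one_le_of_lt (hs ha)
    exact lt_of_lt_of_le (Order.lt_add_one_iff.2 le_rfl) (le_csSup hb ⟨x, hx, rfl⟩)

theorem aux_lt {κ : Cardinal.{0}} {s : Set Ordinal.{0}} {γ : Ordinal.{0}}
    (hγ : γ < κ.ord) (h : s ⊆ Set.Iio γ) : #↥s < Cardinal.lift.{1} κ := by
  refine (Cardinal.mk_le_mk_of_subset h).trans_lt ?_
  rw [Cardinal.mk_Iio_ordinal, Cardinal.lift_lt]
  exact Cardinal.lt_ord.1 hγ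

theorem aux_unbdd {κ : Cardinal.{0}} {s : Set Ordinal.{0}}
    (hs : HasCardOf s κ) {γ : Ordinal.{0}} (hγ : γ < κ.ord) : ∃ x ∈ s, γ ≤ x := by
  by_contra! hcon
  exact (aux_lt hγ (s := s) hcon).ne hs

theorem aux_not {κ : Cardinal.{0}} (hreg : κ.IsRegular) {s : Set Ordinal.{0}}
    (hs : s ⊆ Set.Iio κ.ord) (hc : ¬ HasCardOf s κ) :
    ∃ γ < κ.ord, ∀ x ∈ s, x < γ := by
  apply aux_bdd hreg hs
  refine lt_of_le_of_ne ?_ hc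
  refine (Cardinal.mk_le_mk_of_subset hs).trans ?_
  rw [Cardinal.mk_Iio_ordinal, Cardinal.card_ord]

theorem aux_unreaped {κ : Cardinal.{0}} (hreg : κ.IsRegular) {R : Set (Set Ordinal.{0})}
    (hR : ∀ y ∈ R, y ⊆ Set.Iio κ.ord ∧ HasCardOf y κ)
    (hun : Unreaped κ R) (T : Set Ordinal.{0}) :
    ∃ y ∈ R, ∃ γ < κ.ord,
      (∀ x ∈ y, γ ≤ x → x ∉ T) ∨ (∀ x ∈ y, γ ≤ x → x ∈ T) := by
  by_contra! hcon
  have key : ∀ y ∈ R, Splits κ (Set.Iio κ.ord ∩ T) y := by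
    intro y hy
    refine ⟨?_, ?_⟩
    · by_contra hc
      obtain ⟨γ, hγ, h⟩ := aux_not hreg (fun x hx => hx.1.1) hc
      obtain ⟨x, hx, h1, h2⟩ := (hcon y hy γ hγ).1
      exact absurd (h x ⟨⟨(hR y hy).1 hx, h2⟩, hx⟩) (not_lt.2 h1)
    · by_contra hc
      obtain ⟨γ, hγ, h⟩ := aux_not hreg (fun x hx => hx.1.1) hc
      obtain ⟨x, hx, h1, h2⟩ := (hcon y hy γ hγ).2
      exact absurd (h x ⟨⟨(hR y hy).1 hx, fun h => h2 h.2⟩, hx⟩) (not_lt.2 h1)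
  by_cases hne : R.Nonempty
  · obtain ⟨y, hy⟩ := hne
    apply hun
    refine ⟨_, Set.inter_subset_left, ?_, key⟩
    by_contra hc
    obtain ⟨γ, hγ, h⟩ := aux_not hreg Set.inter_subset_left hc
    obtain ⟨x, hx, h1⟩ := aux_unbdd (key y hy).1 hγ
    exact absurd (h x hx.1) (not_lt.2 h1)
  · apply hun
    refine ⟨Set.Iio κ.ord, le_rfl, ?_, fun y hy => absurd ⟨y, hy⟩ hne⟩
    unfold HasCardOf
    rw [Cardinal.mk_Iio_ordinal, Cardinal.card_ord]

theorem aux_idx {κ : Cardinal.{0}} (hreg : κ.IsRegular) (g : Ordinal.{0} → Ordinal.{0})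
    (hg : ∀ β < κ.ord, g β < κ.ord) :
    ∃ i : Ordinal.{0} → Ordinal.{0}, Monotone i ∧ (∀ β, i β ≤ β) ∧
      (∀ ξ < κ.ord, ∃ β < κ.ord, ξ ≤ i β) ∧
      (∀ β x, x ≤ g β → i x ≤ i β + 1) := by
  let r : Ordinal.{0} → Ordinal.{0} → Prop := fun γ β => ∀ δ ≤ γ, g δ < β
  let i : Ordinal.{0} → Ordinal.{0} := WellFounded.fix (C := fun _ => Ordinal.{0})
    (wellFounded_lt (α := Ordinal.{0}))
    (fun β IH => sInf {o | ∀ γ (h : γ < β), r γ β → IH γ h < o})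
  have hi : ∀ β, i β = sInf {o | ∀ γ, γ < β → r γ β → i γ < o} := by
    intro β
    exact WellFounded.fix_eq _ _ _
  have hle : ∀ β, i β ≤ β := by
    intro β
    induction β using WellFoundedLT.induction with
    | ind β ih =>
      rw [hi]
      exact csInf_le' (fun γ h _ => (ih γ h).trans_lt h)
  have hlt : ∀ β γ, γ < β → r γ β → i γ < i β := by
    intro β
    have := csInf_mem (s := {o | ∀ γ, γ < β → r γ β → i γ < o})
      ⟨β, fun γ h _ => (hle γ).trans_lt h⟩
    rw [← hi] at this
    exact this
  have hmin : ∀ β o, (∀ γ, γ < β → r γ β → i γ < o) → i β ≤ o := by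
    intro β o h
    rw [hi]
    exact csInf_le' h
  have hmono : Monotone i := by
    intro a b hab
    apply hmin
    intro γ h1 h2
    exact hlt b γ (h1.trans_le hab) (fun δ hδ => (h2 δ hδ).trans_le hab)
  have hlim : Order.IsSuccLimit κ.ord := Cardinal.isSuccLimit_ord hreg.aleph0_le
  have hsucc : ∀ γ < κ.ord, ∃ x < κ.ord, γ < x ∧ r γ x := by
    intro γ hγ
    have hγ' : γ + 1 < κ.ord := hlim.add_one_lt hγ
    obtain ⟨b, hb, h⟩ := aux_bdd hreg (s := g '' Set.Iio (γ + 1)) (by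
      rintro _ ⟨a, ha, rfl⟩
      exact hg a (lt_trans ha hγ')) (Cardinal.mk_image_le.trans_lt (aux_lt hγ' le_rfl))
    refine ⟨max b (γ + 1), max_lt hb hγ', lt_max_of_lt_right (Order.lt_add_one_iff.2 le_rfl), ?_⟩
    intro δ hδ
    exact lt_max_of_lt_left (h _ ⟨δ, Order.lt_add_one_iff.2 hδ, rfl⟩)
  refine ⟨i, hmono, hle, ?_, ?_⟩
  · intro ξ
    induction ξ using WellFoundedLT.induction with
    | ind ξ ih =>
      intro hξ
      have : ∀ η : Ordinal.{0}, ∃ β, η < ξ → β < κ.ord ∧ η ≤ i β := by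
        intro η
        by_cases h : η < ξ
        · obtain ⟨β, h1, h2⟩ := ih η h (h.trans hξ)
          exact ⟨β, fun _ => ⟨h1, h2⟩⟩
        · exact ⟨0, fun h' => absurd h' h⟩
      choose f hf using this
      obtain ⟨b, hb, h⟩ := aux_bdd hreg (s := f '' Set.Iio ξ) (by
        rintro _ ⟨a, ha, rfl⟩
        exact (hf a ha).1) (Cardinal.mk_image_le.trans_lt (aux_lt hξ le_rfl))
      obtain ⟨x, hx, h1, h2⟩ := hsucc b hb
      refine ⟨x, hx, ?_⟩
      by_contra! hcon
      have e1 := (hf _ hcon).2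
      have e2 := hmono (h _ ⟨_, hcon, rfl⟩).le
      exact absurd (hlt x b h1 h2) (not_lt.2 (e1.trans e2))
  · intro β x hx
    apply hmin
    intro γ h1 h2
    rw [Order.lt_add_one_iff]
    apply hmono
    by_contra! hcon
    exact absurd (h2 β hcon.le) (not_lt.2 hx)

theorem aux_four (a : Ordinal.{0}) : ∃ q : Ordinal.{0}, ∃ n : ℕ, n < 4 ∧ a = 4 * q + n := by
  have h4 : (4 : Ordinal.{0}) ≠ 0 := by norm_num
  have h := Ordinal.mod_lt a h4
  have hω : a % 4 < Ordinal.omega0 := h.trans (Ordinal.natCast_lt_omega0 4)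
  obtain ⟨n, hn⟩ := Ordinal.lt_omega0.1 hω
  refine ⟨a / 4, n, ?_, ?_⟩
  · rw [hn] at h
    exact_mod_cast h
  · rw [← hn, Ordinal.div_add_mod]

theorem aux_div (q : Ordinal.{0}) (m : ℕ) :
    (4 * q + (m : Ordinal.{0})) / 4 = q + ((m / 4 : ℕ) : Ordinal.{0}) := by
  rw [Ordinal.mul_add_div _ (by norm_num), Ordinal.natCast_div]
  rfl

theorem aux_mod (q : Ordinal.{0}) (m : ℕ) :
    (4 * q + (m : Ordinal.{0})) % 4 = ((m % 4 : ℕ) : Ordinal.{0}) := by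
  rw [Ordinal.mul_add_mod_self, Ordinal.natCast_mod]
  rfl

/-- Index arithmetic. -/
theorem aux_arith (a b c : Ordinal.{0}) (hb : b = a ∨ b = a + 1) (hc : c = a ∨ c = a + 1) :
    (b % 4 = 0 ∨ b % 4 = 3 → (c + 2) / 4 = (a + 2) / 4) ∧
    (¬ (b % 4 = 0 ∨ b % 4 = 3) → c / 4 = a / 4) := by
  obtain ⟨q, n, hn, rfl⟩ := aux_four a
  have e1 : 4 * q + (n : Ordinal.{0}) + 1 = 4 * q + ((n + 1 : ℕ) : Ordinal.{0}) := by
    rw [add_assoc]; push_cast; rfl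
  have e2 : ∀ m : ℕ, 4 * q + (m : Ordinal.{0}) + 2 = 4 * q + ((m + 2 : ℕ) : Ordinal.{0}) := by
    intro m
    rw [add_assoc]; push_cast; rfl
  have hb' : ∃ m : ℕ, (m = n ∨ m = n + 1) ∧ b = 4 * q + (m : Ordinal.{0}) := by
    rcases hb with rfl | rfl
    · exact ⟨n, Or.inl rfl, rfl⟩
    · exact ⟨n + 1, Or.inr rfl, e1⟩
  have hc' : ∃ m : ℕ, (m = n ∨ m = n + 1) ∧ c = 4 * q + (m : Ordinal.{0}) := by
    rcases hc with rfl | rfl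
    · exact ⟨n, Or.inl rfl, rfl⟩
    · exact ⟨n + 1, Or.inr rfl, e1⟩
  obtain ⟨m, hm, rfl⟩ := hb'
  obtain ⟨k, hk, rfl⟩ := hc'
  have e3 : ((m % 4 : ℕ) : Ordinal.{0}) = 0 ↔ m % 4 = 0 := by norm_cast
  have e4 : ((m % 4 : ℕ) : Ordinal.{0}) = 3 ↔ m % 4 = 3 := by norm_cast
  rw [e2, e2, aux_mod, aux_div, aux_div, aux_div, aux_div, e3, e4]
  constructor
  · intro h
    have : (k + 2) / 4 = (n + 2) / 4 := by omega
    rw [this]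
  · intro h
    have : k / 4 = n / 4 := by omega
    rw [this]

theorem aux_fun {κ : Cardinal.{0}} (hreg : κ.IsRegular) (g : Ordinal.{0} → Ordinal.{0})
    (hg : ∀ β < κ.ord, g β < κ.ord) :
    ∃ (h0 h1 : Ordinal.{0} → Ordinal.{0}) (A : Set Ordinal.{0}),
      (Monotone h0 ∧ (∀ β < κ.ord, h0 β < κ.ord) ∧ (∀ ξ < κ.ord, ∃ β < κ.ord, ξ < h0 β)) ∧
      (Monotone h1 ∧ (∀ β < κ.ord, h1 β < κ.ord) ∧ (∀ ξ < κ.ord, ∃ β < κ.ord, ξ < h1 β)) ∧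
      (∀ β x w, β ≤ x → x ≤ g β → β ≤ w → w ≤ g β →
        (x ∈ A → h1 w = h1 β) ∧ (x ∉ A → h0 w = h0 β)) := by
  obtain ⟨i, hmono, hle, hunb, hstep⟩ := aux_idx hreg g hg
  have hlim : Order.IsSuccLimit κ.ord := Cardinal.isSuccLimit_ord hreg.aleph0_le
  have hdm : Monotone (fun a : Ordinal.{0} => a / 4) := fun a b h => Ordinal.div_le_left h 4
  have hdl : ∀ a : Ordinal.{0}, a / 4 ≤ a := by
    intro a
    refine Ordinal.div_le_of_le_mul ?_
    exact le_mul_of_one_le_left' (by norm_num)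
  have h4 : (4 : Ordinal.{0}) < κ.ord :=
    (Ordinal.natCast_lt_omega0 4).trans_le (by
      rw [← Cardinal.ord_aleph0]; exact Cardinal.ord_le_ord.2 hreg.aleph0_le)
  have hm0 : Monotone (fun β => i β / 4) := hdm.comp hmono
  have hm1 : Monotone (fun β => (i β + 2) / 4) := by
    intro a b h
    exact hdm (by gcongr; exact hmono h)
  have hun0 : ∀ ξ < κ.ord, ∃ β < κ.ord, ξ < i β / 4 := by
    intro ξ hξ
    obtain ⟨β, hβ, h⟩ := hunb (4 * (ξ + 1))
      (Ordinal.isPrincipal_mul_ord hreg.aleph0_le h4 (hlim.add_one_lt hξ))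
    refine ⟨β, hβ, ?_⟩
    rw [← Order.add_one_le_iff, ← Ordinal.mul_le_iff_le_div (by norm_num)]
    exact h
  refine ⟨fun β => i β / 4, fun β => (i β + 2) / 4, {x | i x % 4 = 0 ∨ i x % 4 = 3},
    ⟨hm0, ?_, hun0⟩, ⟨hm1, ?_, ?_⟩, ?_⟩
  · intro β hβ
    exact ((hdl _).trans (hle β)).trans_lt hβ
  · intro β hβ
    refine (hdl _).trans_lt ?_
    have h1 := hlim.add_one_lt (hlim.add_one_lt ((hle β).trans_lt hβ))
    rwa [add_assoc, one_add_one_eq_two] at h1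
  · intro ξ hξ
    obtain ⟨β, hβ, h⟩ := hun0 ξ hξ
    exact ⟨β, hβ, h.trans_le (hdm (by simp))⟩
  · intro β x w hx hx' hw hw'
    have key : ∀ x, β ≤ x → x ≤ g β → i x = i β ∨ i x = i β + 1 := by
      intro x hx hx'
      rcases (hmono hx).eq_or_lt with h | h
      · exact Or.inl h.symm
      · exact Or.inr (le_antisymm (hstep β x hx') (Order.add_one_le_of_lt h))
    exact aux_arith _ _ _ (key x hx hx') (key w hw hw')

theorem aux_proj {κ : Cardinal.{0}} {y : Set Ordinal.{0}} (hy : HasCardOf y κ)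
    {β : Ordinal.{0}} (hβ : β < κ.ord) : proj y β ∈ y ∧ β ≤ proj y β := by
  obtain ⟨x, hx, h⟩ := aux_unbdd hy hβ
  exact csInf_mem (s := y ∩ Set.Ici β) ⟨x, hx, h⟩

/-- If `U ∩ h''Z` has size `κ` then some `β ∈ Z` beyond `γ` has `h β ∈ U`. -/
theorem aux_core {κ : Cardinal.{0}} (hreg : κ.IsRegular) {h : Ordinal.{0} → Ordinal.{0}}
    (hm : Monotone h) (hk : ∀ β < κ.ord, h β < κ.ord) {U Z : Set Ordinal.{0}}
    (hc : HasCardOf (U ∩ h '' Z) κ) {γ : Ordinal.{0}} (hγ : γ < κ.ord) :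
    ∃ β ∈ Z, γ ≤ β ∧ h β ∈ U := by
  have hlim : Order.IsSuccLimit κ.ord := Cardinal.isSuccLimit_ord hreg.aleph0_le
  obtain ⟨_, ⟨hU, β, hβ, rfl⟩, hx⟩ := aux_unbdd hc (hlim.add_one_lt (hk γ hγ))
  refine ⟨β, hβ, ?_, hU⟩
  by_contra! hcon
  exact absurd (hm hcon.le) (not_le.2 (Order.add_one_le_iff.1 hx))

/-- Contradiction from a splitting set for `h`. -/
theorem aux_final {κ : Cardinal.{0}} (hreg : κ.IsRegular) {R : Set (Set Ordinal.{0})}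
    (hR : ∀ y ∈ R, y ⊆ Set.Iio κ.ord ∧ HasCardOf y κ)
    (hun : Unreaped κ R) {g h : Ordinal.{0} → Ordinal.{0}}
    (hm : Monotone h) (hk : ∀ β < κ.ord, h β < κ.ord) {B : Set Ordinal.{0}}
    (hB : ∀ β x w, β ≤ x → x ≤ g β → β ≤ w → w ≤ g β → x ∈ B → h w = h β)
    {y : Set Ordinal.{0}} (hy : y ∈ R) {γ : Ordinal.{0}} (hγ : γ < κ.ord)
    (hyB : ∀ x ∈ y, γ ≤ x → x ∈ B) {S : Set Ordinal.{0}}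
    (hS : ∀ z ∈ R, Splits κ S (h '' ({β : Ordinal | β < κ.ord ∧ proj y β ≤ g β} ∩
      {β : Ordinal | β < κ.ord ∧ proj z β ≤ g β}))) : False := by
  obtain ⟨z, hz, γ', hγ', hzT⟩ := aux_unreaped hreg hR hun (h ⁻¹' S)
  have key : ∀ β, β < κ.ord → γ ≤ β → proj y β ≤ g β → proj z β ≤ g β →
      h (proj z β) = h β := by
    intro β hβ h1 h2 h3
    obtain ⟨a1, a2⟩ := aux_proj (hR y hy).2 hβ
    obtain ⟨b1, b2⟩ := aux_proj (hR z hz).2 hβ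
    exact hB β _ _ a2 h2 b2 h3 (hyB _ a1 (h1.trans a2))
  have hmax : max γ γ' < κ.ord := max_lt hγ hγ'
  rcases hzT with hzT | hzT
  · obtain ⟨β, ⟨⟨hβ, h2⟩, ⟨_, h3⟩⟩, h1, hU⟩ := aux_core hreg hm hk (hS z hz).1 hmax
    obtain ⟨b1, b2⟩ := aux_proj (hR z hz).2 hβ
    apply hzT _ b1 (((le_max_right _ _).trans h1).trans b2)
    rw [Set.mem_preimage, key β hβ ((le_max_left _ _).trans h1) h2 h3]
    exact hU
  · obtain ⟨β, ⟨⟨hβ, h2⟩, ⟨_, h3⟩⟩, h1, hU⟩ := aux_core hreg hm hk (hS z hz).2 hmax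
    obtain ⟨b1, b2⟩ := aux_proj (hR z hz).2 hβ
    have := hzT _ b1 (((le_max_right _ _).trans h1).trans b2)
    rw [Set.mem_preimage, key β hβ ((le_max_left _ _).trans h1) h2 h3] at this
    exact hU.2 this

/-- If `κ` is regular and `R` is an unreaped (`𝔯_κ`) family, then
`H = {p_y : y ∈ R}` is a big family of functions in `κ^κ`. -/
theorem stmt6 (κ : Cardinal.{0}) (hreg : κ.IsRegular)
    (R : Set (Set Ordinal))
    (hR : ∀ y ∈ R, y ⊆ Set.Iio κ.ord ∧ HasCardOf y κ)
    (hunreaped : Unreaped κ R) :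
    BigFamily κ {p : Ordinal.{0} → Ordinal.{0} | ∃ y ∈ R, p = proj y} := by
  intro F g hF hg hH
  obtain ⟨h0, h1, A, ⟨hm0, hk0, hu0⟩, ⟨hm1, hk1, hu1⟩, hA⟩ := aux_fun hreg g hg
  have hfib : ∀ h : Ordinal.{0} → Ordinal.{0}, Monotone h → (∀ β < κ.ord, h β < κ.ord) →
      (∀ ξ < κ.ord, ∃ β < κ.ord, ξ < h β) →
      ∀ ξ : Ordinal, #↥(Set.Iio κ.ord ∩ h ⁻¹' {ξ}) < Cardinal.lift.{1} κ := by
    intro h hm hk hu ξ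
    by_cases hξ : ξ < κ.ord
    · obtain ⟨β, hβ, hlt⟩ := hu ξ hξ
      refine aux_lt hβ ?_
      rintro x ⟨_, hx⟩
      have hx' : h x = ξ := hx
      rw [Set.mem_Iio]
      by_contra! hcon
      exact absurd (hm hcon) (not_le.2 (hx' ▸ hlt))
    · have h0' : (0 : Ordinal.{0}) < κ.ord := by
        rw [Cardinal.lt_ord, Ordinal.card_zero]
        exact hreg.pos
      refine aux_lt h0' ?_
      rintro x ⟨hx1, hx⟩
      have hx' : h x = ξ := hx
      exact absurd (hx' ▸ hk x hx1) hξ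
  by_contra! hcon
  have c0 := hcon h0 (hm0.monotoneOn _) hk0 (hfib h0 hm0 hk0 hu0)
  have c1 := hcon h1 (hm1.monotoneOn _) hk1 (hfib h1 hm1 hk1 hu1)
  unfold Unreaped at c0 c1
  rw [not_not] at c0 c1
  obtain ⟨S0, -, -, hS0⟩ := c0
  obtain ⟨S1, -, -, hS1⟩ := c1
  have hZ : ∀ y ∈ R, {β : Ordinal | β < κ.ord ∧ proj y β ≤ g β} ∈ F :=
    fun y hy => hH _ ⟨y, hy, rfl⟩
  obtain ⟨y, hy, γ, hγ, hyA | hyA⟩ := aux_unreaped hreg hR hunreaped A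
  · refine aux_final hreg hR hunreaped (g := g) (B := Aᶜ) hm0 hk0 ?_ hy hγ hyA
      (S := S0) (fun z hz => hS0 _ ⟨_, hZ y hy, _, hZ z hz, rfl⟩)
    intro β x w a b c d e
    exact (hA β x w a b c d).2 e
  · refine aux_final hreg hR hunreaped (g := g) (B := A) hm1 hk1 ?_ hy hγ hyA
      (S := S1) (fun z hz => hS1 _ ⟨_, hZ y hy, _, hZ z hz, rfl⟩)
    intro β x w a b c d e
    exact (hA β x w a b c d).1 e
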